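/- Let N ≥ 1, l ≥ 1, and x0 ∈ F_{N+l} such that along the horizon-(N+l) optimal solution no state or input constraint is active at the stages N,…,N+l−1 and no terminal constraint is active, i.e., Cx x*_{N+l}(x0,k) < cx and Cu u*_{N+l}(x0,k) < cu componentwise for N ≤ k ≤ N+l−1 and Ct x*_{N+l}(x0,N+l) < ct componentwise. Then x0 ∈ F_N, the truncation (u*_{N+l}(x0,0),…,u*_{N+l}(x0,N−1)) is the unique optimal sequence for horizon N at x0, no terminal constraint is active for horizon N (Ct x*_N(x0,N) < ct componentwise, equivalently x*_N(x0,N) ∈ int T), the horizon-N active pattern of x0 agrees with the horizon-(N+l) active pattern on the stages 0,…,N−1, and u*_{N+l}(x0,k) = K∞ x*_{N+l}(x0,k) for N ≤ k ≤ N+l−1. -/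

import Mathlib

open Matrix Set

noncomputable section

/-- State trajectory generated by dynamics `x(k+1) = A x(k) + B u(k)` from `x0`. -/
def traj {n m : ℕ} (A : Matrix (Fin n) (Fin n) ℝ) (B : Matrix (Fin n) (Fin m) ℝ)
    (x0 : Fin n → ℝ) (u : ℕ → Fin m → ℝ) : ℕ → Fin n → ℝ
  | 0 => x0
  | k + 1 => A *ᵥ traj A B x0 u k + B *ᵥ u k

/-- Feasibility of a control sequence for horizon `N` and initial state `x0`. -/
def Feasible {n m qX qU qT : ℕ} (A : Matrix (Fin n) (Fin n) ℝ) (B : Matrix (Fin n) (Fin m) ℝ)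
    (Cx : Matrix (Fin qX) (Fin n) ℝ) (cx : Fin qX → ℝ)
    (Cu : Matrix (Fin qU) (Fin m) ℝ) (cu : Fin qU → ℝ)
    (Ct : Matrix (Fin qT) (Fin n) ℝ) (ct : Fin qT → ℝ)
    (N : ℕ) (x0 : Fin n → ℝ) (u : ℕ → Fin m → ℝ) : Prop :=
  (∀ k < N, Cx *ᵥ traj A B x0 u k ≤ cx ∧ Cu *ᵥ u k ≤ cu) ∧
    Ct *ᵥ traj A B x0 u N ≤ ct

/-- The quadratic cost `J_N(x0, u)`. -/
def cost {n m : ℕ} (A : Matrix (Fin n) (Fin n) ℝ) (B : Matrix (Fin n) (Fin m) ℝ)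
    (Q : Matrix (Fin n) (Fin n) ℝ) (R : Matrix (Fin m) (Fin m) ℝ)
    (P : Matrix (Fin n) (Fin n) ℝ)
    (N : ℕ) (x0 : Fin n → ℝ) (u : ℕ → Fin m → ℝ) : ℝ :=
  (1 / 2) * (traj A B x0 u N ⬝ᵥ (P *ᵥ traj A B x0 u N)) +
    (1 / 2) * ∑ k ∈ Finset.range N,
      (traj A B x0 u k ⬝ᵥ (Q *ᵥ traj A B x0 u k) + u k ⬝ᵥ (R *ᵥ u k))

/-- `u` is an optimal (feasible, cost-minimizing) sequence for horizon `N` at `x0`. -/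
def IsOptimal {n m qX qU qT : ℕ} (A : Matrix (Fin n) (Fin n) ℝ) (B : Matrix (Fin n) (Fin m) ℝ)
    (Q : Matrix (Fin n) (Fin n) ℝ) (R : Matrix (Fin m) (Fin m) ℝ)
    (P : Matrix (Fin n) (Fin n) ℝ)
    (Cx : Matrix (Fin qX) (Fin n) ℝ) (cx : Fin qX → ℝ)
    (Cu : Matrix (Fin qU) (Fin m) ℝ) (cu : Fin qU → ℝ)
    (Ct : Matrix (Fin qT) (Fin n) ℝ) (ct : Fin qT → ℝ)
    (N : ℕ) (x0 : Fin n → ℝ) (u : ℕ → Fin m → ℝ) : Prop :=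
  Feasible A B Cx cx Cu cu Ct ct N x0 u ∧
    ∀ v, Feasible A B Cx cx Cu cu Ct ct N x0 v →
      cost A B Q R P N x0 u ≤ cost A B Q R P N x0 v

/-- The feasible set `F_N` of initial states. -/
def FeasSet {n m qX qU qT : ℕ} (A : Matrix (Fin n) (Fin n) ℝ) (B : Matrix (Fin n) (Fin m) ℝ)
    (Cx : Matrix (Fin qX) (Fin n) ℝ) (cx : Fin qX → ℝ)
    (Cu : Matrix (Fin qU) (Fin m) ℝ) (cu : Fin qU → ℝ)
    (Ct : Matrix (Fin qT) (Fin n) ℝ) (ct : Fin qT → ℝ)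
    (N : ℕ) : Set (Fin n → ℝ) :=
  {x0 | ∃ u, Feasible A B Cx cx Cu cu Ct ct N x0 u}

/-- Completion of squares for the Riccati equation: one stage of the LQR cost. -/
lemma riccati_stage {n m : ℕ} {A : Matrix (Fin n) (Fin n) ℝ} {B : Matrix (Fin n) (Fin m) ℝ}
    {Q P : Matrix (Fin n) (Fin n) ℝ} {R : Matrix (Fin m) (Fin m) ℝ} {K : Matrix (Fin m) (Fin n) ℝ}
    (hR : R.IsSymm) (hP : P.IsSymm) (hdet : IsUnit (R + Bᵀ * P * B).det)
    (hRic : P = Aᵀ * (P - P * B * (R + Bᵀ * P * B)⁻¹ * (Bᵀ * P)) * A + Q)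
    (hK : K = -((Bᵀ * P * B + R)⁻¹ * (Bᵀ * P * A))) (x : Fin n → ℝ) (w : Fin m → ℝ) :
    x ⬝ᵥ (Q *ᵥ x) + w ⬝ᵥ (R *ᵥ w) + (A *ᵥ x + B *ᵥ w) ⬝ᵥ (P *ᵥ (A *ᵥ x + B *ᵥ w)) =
      x ⬝ᵥ (P *ᵥ x) + (w - K *ᵥ x) ⬝ᵥ ((R + Bᵀ * P * B) *ᵥ (w - K *ᵥ x)) := by
  rw [add_comm (Bᵀ * P * B) R] at hK
  have hS : (R + Bᵀ * P * B)ᵀ = R + Bᵀ * P * B := by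
    simp [Matrix.transpose_add, Matrix.transpose_mul, hR.eq, hP.eq, Matrix.mul_assoc]
  have hSK : (R + Bᵀ * P * B) * K = -(Bᵀ * P * A) := by
    rw [hK, Matrix.mul_neg, Matrix.mul_nonsing_inv_cancel_left _ _ hdet]
  have hKS : Kᵀ * (R + Bᵀ * P * B) = -(Aᵀ * P * B) := by
    have := congrArg Matrix.transpose hSK
    rw [Matrix.transpose_mul, hS] at this
    simpa [Matrix.transpose_mul, hP.eq, Matrix.mul_assoc] using this
  have hKBPA : Kᵀ * Bᵀ * P * A = Aᵀ * P * B * K := by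
    have := congrArg (Kᵀ * ·) hSK
    simp only [← Matrix.mul_assoc, hKS, Matrix.neg_mul, Matrix.mul_neg, neg_inj] at this
    exact this.symm
  have hPK : P = Aᵀ * P * A + Q + Aᵀ * P * B * K := by
    conv_lhs => rw [hRic]
    rw [hK]
    simp only [Matrix.mul_sub, Matrix.sub_mul, Matrix.mul_neg, Matrix.mul_assoc]
    abel
  have hdot : ∀ {a b : ℕ} (M : Matrix (Fin a) (Fin b) ℝ) (y : Fin b → ℝ) (z : Fin a → ℝ),
      (M *ᵥ y) ⬝ᵥ z = y ⬝ᵥ (Mᵀ *ᵥ z) := fun M y z => by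
    rw [Matrix.dotProduct_mulVec, Matrix.vecMul_transpose]
  have hPx : x ⬝ᵥ (P *ᵥ x) = x ⬝ᵥ ((Aᵀ * P * A) *ᵥ x) + x ⬝ᵥ (Q *ᵥ x) +
      x ⬝ᵥ ((Aᵀ * P * B * K) *ᵥ x) := by
    conv_lhs => rw [hPK]
    simp only [Matrix.add_mulVec, dotProduct_add]
  rw [hPx]
  generalize hSdef : R + Bᵀ * P * B = S at *
  have hwSw : w ⬝ᵥ (S *ᵥ w) = w ⬝ᵥ (R *ᵥ w) + w ⬝ᵥ ((Bᵀ * P * B) *ᵥ w) := by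
    rw [← hSdef, Matrix.add_mulVec, dotProduct_add]
  simp only [Matrix.mulVec_add, Matrix.mulVec_sub, dotProduct_add, add_dotProduct,
    dotProduct_sub, sub_dotProduct, hdot, Matrix.mulVec_mulVec, ← Matrix.mul_assoc, hKS, hSK,
    Matrix.neg_mulVec, dotProduct_neg, hKBPA, hwSw]
  ring

/-- The LQR cost of a control sequence as the value function plus weighted deviations from the
LQR feedback. -/
lemma cost_eq_add_sum {n m : ℕ} {A : Matrix (Fin n) (Fin n) ℝ} {B : Matrix (Fin n) (Fin m) ℝ}
    {Q P : Matrix (Fin n) (Fin n) ℝ} {R S : Matrix (Fin m) (Fin m) ℝ}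
    {K : Matrix (Fin m) (Fin n) ℝ}
    (hstage : ∀ x w, x ⬝ᵥ (Q *ᵥ x) + w ⬝ᵥ (R *ᵥ w) +
      (A *ᵥ x + B *ᵥ w) ⬝ᵥ (P *ᵥ (A *ᵥ x + B *ᵥ w)) =
        x ⬝ᵥ (P *ᵥ x) + (w - K *ᵥ x) ⬝ᵥ (S *ᵥ (w - K *ᵥ x)))
    (x0 : Fin n → ℝ) (u : ℕ → Fin m → ℝ) (M : ℕ) :
    cost A B Q R P M x0 u = (1 / 2) * (x0 ⬝ᵥ (P *ᵥ x0)) +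
      (1 / 2) * ∑ k ∈ Finset.range M,
        (u k - K *ᵥ traj A B x0 u k) ⬝ᵥ (S *ᵥ (u k - K *ᵥ traj A B x0 u k)) := by
  induction M with
  | zero => simp [cost, traj]
  | succ M ih =>
    have h := hstage (traj A B x0 u M) (u M)
    simp only [cost, traj, Finset.sum_range_succ] at ih ⊢
    linarith

lemma traj_congr {n m : ℕ} (A : Matrix (Fin n) (Fin n) ℝ) (B : Matrix (Fin n) (Fin m) ℝ)
    (x0 : Fin n → ℝ) {u v : ℕ → Fin m → ℝ} {M : ℕ} (h : ∀ k < M, u k = v k) :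
    ∀ k ≤ M, traj A B x0 u k = traj A B x0 v k := by
  intro k hk
  induction k with
  | zero => rfl
  | succ k ih => simp only [traj]; rw [ih (by omega), h k (by omega)]

lemma traj_combo {n m : ℕ} (A : Matrix (Fin n) (Fin n) ℝ) (B : Matrix (Fin n) (Fin m) ℝ)
    (x0 : Fin n → ℝ) (u v : ℕ → Fin m → ℝ) (t : ℝ) (k : ℕ) :
    traj A B x0 (fun j => u j + t • (v j - u j)) k =
      traj A B x0 u k + t • (traj A B x0 v k - traj A B x0 u k) := by
  induction k with
  | zero => simp [traj]
  | succ k ih =>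
    simp only [traj, ih, Matrix.mulVec_add, Matrix.mulVec_smul, Matrix.mulVec_sub]
    module

/-- Follow `u` for `N` steps, then the state feedback `K`. -/
def feedbackExt {n m : ℕ} (A : Matrix (Fin n) (Fin n) ℝ) (B : Matrix (Fin n) (Fin m) ℝ)
    (K : Matrix (Fin m) (Fin n) ℝ) (N : ℕ) (x0 : Fin n → ℝ) (u : ℕ → Fin m → ℝ) :
    ℕ → Fin m → ℝ :=
  fun k => if k < N then u k
    else K *ᵥ (((A + B * K) ^ (k - N)) *ᵥ traj A B x0 u N)

lemma feedbackExt_of_lt {n m : ℕ} {A : Matrix (Fin n) (Fin n) ℝ} {B : Matrix (Fin n) (Fin m) ℝ}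
    {K : Matrix (Fin m) (Fin n) ℝ} {N : ℕ} {x0 : Fin n → ℝ} {u : ℕ → Fin m → ℝ} {k : ℕ}
    (hk : k < N) : feedbackExt A B K N x0 u k = u k := if_pos hk

lemma add_mulVec_feedback {n m : ℕ} (A : Matrix (Fin n) (Fin n) ℝ)
    (B : Matrix (Fin n) (Fin m) ℝ) (K : Matrix (Fin m) (Fin n) ℝ) (x : Fin n → ℝ) :
    A *ᵥ x + B *ᵥ (K *ᵥ x) = (A + B * K) *ᵥ x := by
  rw [Matrix.add_mulVec, Matrix.mulVec_mulVec]

/-- Under the state feedback `K` from stage `N` on, states are powers of `A + B K`. -/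
lemma traj_add_eq_pow_mulVec {n m : ℕ} {A : Matrix (Fin n) (Fin n) ℝ}
    {B : Matrix (Fin n) (Fin m) ℝ} {K : Matrix (Fin m) (Fin n) ℝ} {N l : ℕ} {x0 : Fin n → ℝ}
    {u : ℕ → Fin m → ℝ} (h : ∀ k < l, u (N + k) = K *ᵥ traj A B x0 u (N + k)) :
    ∀ k ≤ l, traj A B x0 u (N + k) = ((A + B * K) ^ k) *ᵥ traj A B x0 u N := by
  intro k hk
  induction k with
  | zero => simp
  | succ k ih =>
    rw [← add_assoc]
    simp only [traj]
    rw [h k (by omega), ih (by omega), add_mulVec_feedback, Matrix.mulVec_mulVec, ← pow_succ']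

lemma traj_feedbackExt_of_le {n m : ℕ} (A : Matrix (Fin n) (Fin n) ℝ)
    (B : Matrix (Fin n) (Fin m) ℝ) (K : Matrix (Fin m) (Fin n) ℝ) (N : ℕ) (x0 : Fin n → ℝ)
    (u : ℕ → Fin m → ℝ) {k : ℕ} (hk : k ≤ N) :
    traj A B x0 (feedbackExt A B K N x0 u) k = traj A B x0 u k :=
  traj_congr A B x0 (fun _ hj => feedbackExt_of_lt hj) k hk

lemma traj_feedbackExt_add {n m : ℕ} (A : Matrix (Fin n) (Fin n) ℝ)
    (B : Matrix (Fin n) (Fin m) ℝ) (K : Matrix (Fin m) (Fin n) ℝ) (N : ℕ) (x0 : Fin n → ℝ)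
    (u : ℕ → Fin m → ℝ) (k : ℕ) :
    traj A B x0 (feedbackExt A B K N x0 u) (N + k) =
      ((A + B * K) ^ k) *ᵥ traj A B x0 u N := by
  induction k with
  | zero => simp [traj_feedbackExt_of_le]
  | succ k ih =>
    have hk : feedbackExt A B K N x0 u (N + k) =
        K *ᵥ (((A + B * K) ^ k) *ᵥ traj A B x0 u N) := by
      simp [feedbackExt]
    rw [← add_assoc]
    simp only [traj]
    rw [hk, ih, add_mulVec_feedback, Matrix.mulVec_mulVec, ← pow_succ']

lemma feedbackExt_add {n m : ℕ} (A : Matrix (Fin n) (Fin n) ℝ)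
    (B : Matrix (Fin n) (Fin m) ℝ) (K : Matrix (Fin m) (Fin n) ℝ) (N : ℕ) (x0 : Fin n → ℝ)
    (u : ℕ → Fin m → ℝ) (k : ℕ) :
    feedbackExt A B K N x0 u (N + k) =
      K *ᵥ traj A B x0 (feedbackExt A B K N x0 u) (N + k) := by
  rw [traj_feedbackExt_add]
  simp [feedbackExt]

/-- Moving a little from a strictly feasible vector keeps it feasible. -/
lemma eventually_mulVec_le {a q : ℕ} (C : Matrix (Fin q) (Fin a) ℝ) (c : Fin q → ℝ)
    (x y : Fin a → ℝ) (h : ∀ i, (C *ᵥ x) i < c i) :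
    ∀ᶠ t in nhds (0 : ℝ), C *ᵥ (x + t • y) ≤ c := by
  have h' : ∀ᶠ t in nhds (0 : ℝ), ∀ i, (C *ᵥ (x + t • y)) i < c i := by
    rw [Filter.eventually_all]
    intro i
    have hc : Continuous fun t : ℝ => (C *ᵥ (x + t • y)) i := by
      simp only [Matrix.mulVec_add, Matrix.mulVec_smul, Pi.add_apply, Pi.smul_apply]
      fun_prop
    exact hc.continuousAt.eventually_lt continuousAt_const (by simpa using h i)
  exact h'.mono fun t ht i => (ht i).le

lemma mulVec_combo_le {a q : ℕ} {C : Matrix (Fin q) (Fin a) ℝ} {c : Fin q → ℝ}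
    {x y : Fin a → ℝ} {t : ℝ} (h0 : 0 ≤ t) (h1 : t ≤ 1) (hx : C *ᵥ x ≤ c) (hy : C *ᵥ y ≤ c) :
    C *ᵥ (x + t • (y - x)) ≤ c := by
  intro i
  have hxi := hx i
  have hyi := hy i
  simp only [Matrix.mulVec_add, Matrix.mulVec_smul, Matrix.mulVec_sub, Pi.add_apply,
    Pi.smul_apply, Pi.sub_apply, smul_eq_mul]
  nlinarith [mul_le_mul_of_nonneg_left hyi h0, mul_le_mul_of_nonneg_left hxi (sub_nonneg.2 h1)]

/-- If an optimal sequence is strictly feasible from stage `N` on, then its tail is the LQR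
feedback. -/
lemma IsOptimal.tail_eq_feedback {n m qX qU qT : ℕ} {A : Matrix (Fin n) (Fin n) ℝ}
    {B : Matrix (Fin n) (Fin m) ℝ} {Q P : Matrix (Fin n) (Fin n) ℝ}
    {R S : Matrix (Fin m) (Fin m) ℝ} {K : Matrix (Fin m) (Fin n) ℝ}
    {Cx : Matrix (Fin qX) (Fin n) ℝ} {cx : Fin qX → ℝ} {Cu : Matrix (Fin qU) (Fin m) ℝ}
    {cu : Fin qU → ℝ} {Ct : Matrix (Fin qT) (Fin n) ℝ} {ct : Fin qT → ℝ}
    (hS : S.PosDef)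
    (hcost : ∀ (x0 : Fin n → ℝ) (u : ℕ → Fin m → ℝ) (M : ℕ),
      cost A B Q R P M x0 u = (1 / 2) * (x0 ⬝ᵥ (P *ᵥ x0)) +
        (1 / 2) * ∑ k ∈ Finset.range M,
          (u k - K *ᵥ traj A B x0 u k) ⬝ᵥ (S *ᵥ (u k - K *ᵥ traj A B x0 u k)))
    {N l : ℕ} {x0 : Fin n → ℝ} {u : ℕ → Fin m → ℝ}
    (hu : IsOptimal A B Q R P Cx cx Cu cu Ct ct (N + l) x0 u)
    (hinact : ∀ k, N ≤ k → k < N + l →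
      (∀ i, (Cx *ᵥ traj A B x0 u k) i < cx i) ∧ (∀ j, (Cu *ᵥ u k) j < cu j))
    (hterm : ∀ r, (Ct *ᵥ traj A B x0 u (N + l)) r < ct r) :
    ∀ k < l, u (N + k) = K *ᵥ traj A B x0 u (N + k) := by
  set w := feedbackExt A B K N x0 u with hw
  have hfeas : ∀ᶠ t in nhds (0 : ℝ),
      Feasible A B Cx cx Cu cu Ct ct (N + l) x0 (fun j => u j + t • (w j - u j)) := by
    have hstage : ∀ᶠ t in nhds (0 : ℝ), ∀ k ∈ Finset.range (N + l),
        Cx *ᵥ traj A B x0 (fun j => u j + t • (w j - u j)) k ≤ cx ∧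
          Cu *ᵥ (u k + t • (w k - u k)) ≤ cu := by
      rw [Filter.eventually_all_finset]
      intro k hk
      rw [Finset.mem_range] at hk
      simp only [traj_combo]
      rcases lt_or_ge k N with h | h
      · refine Filter.Eventually.of_forall fun t => ?_
        rw [hw, traj_feedbackExt_of_le A B K N x0 u h.le, feedbackExt_of_lt h]
        simpa using hu.1.1 k hk
      · exact (eventually_mulVec_le _ _ _ _ (hinact k h hk).1).and
          (eventually_mulVec_le _ _ _ _ (hinact k h hk).2)
    have hend := eventually_mulVec_le Ct ct (traj A B x0 u (N + l))
      (traj A B x0 w (N + l) - traj A B x0 u (N + l)) hterm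
    filter_upwards [hstage, hend] with t h1 h2
    refine ⟨fun k hk => h1 k (Finset.mem_range.2 hk), ?_⟩
    rwa [traj_combo]
  obtain ⟨ε, hε, hball⟩ := Metric.eventually_nhds_iff.1 hfeas
  set t := min (ε / 2) 1 with ht
  have ht0 : 0 < t := by positivity
  have ht1 : t ≤ 1 := min_le_right _ _
  have htf := hball (y := t) (by
    rw [Real.dist_0_eq_abs, abs_of_pos ht0]
    exact (min_le_left _ _).trans_lt (by linarith))
  have hle := hu.2 _ htf
  rw [hcost, hcost, Finset.sum_range_add, Finset.sum_range_add] at hle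
  have hhead : ∀ k ∈ Finset.range N,
      (u k + t • (w k - u k) - K *ᵥ traj A B x0 (fun j => u j + t • (w j - u j)) k) ⬝ᵥ
        (S *ᵥ (u k + t • (w k - u k) -
          K *ᵥ traj A B x0 (fun j => u j + t • (w j - u j)) k)) =
      (u k - K *ᵥ traj A B x0 u k) ⬝ᵥ (S *ᵥ (u k - K *ᵥ traj A B x0 u k)) := by
    intro k hk
    rw [Finset.mem_range] at hk
    rw [traj_combo, hw, traj_feedbackExt_of_le A B K N x0 u hk.le, feedbackExt_of_lt hk]
    simp
  have htail : ∀ k ∈ Finset.range l,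
      (u (N + k) + t • (w (N + k) - u (N + k)) -
        K *ᵥ traj A B x0 (fun j => u j + t • (w j - u j)) (N + k)) ⬝ᵥ
        (S *ᵥ (u (N + k) + t • (w (N + k) - u (N + k)) -
          K *ᵥ traj A B x0 (fun j => u j + t • (w j - u j)) (N + k))) =
      (1 - t) ^ 2 * ((u (N + k) - K *ᵥ traj A B x0 u (N + k)) ⬝ᵥ
        (S *ᵥ (u (N + k) - K *ᵥ traj A B x0 u (N + k)))) := by
    intro k _
    have he : u (N + k) + t • (w (N + k) - u (N + k)) -
        K *ᵥ traj A B x0 (fun j => u j + t • (w j - u j)) (N + k) =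
        (1 - t) • (u (N + k) - K *ᵥ traj A B x0 u (N + k)) := by
      rw [traj_combo, hw, feedbackExt_add]
      simp only [Matrix.mulVec_add, Matrix.mulVec_smul, Matrix.mulVec_sub]
      module
    rw [he, Matrix.mulVec_smul, dotProduct_smul, smul_dotProduct]
    simp only [smul_eq_mul]
    ring
  rw [Finset.sum_congr rfl hhead, Finset.sum_congr rfl htail, ← Finset.mul_sum] at hle
  have hnn : ∀ k ∈ Finset.range l, 0 ≤ (u (N + k) - K *ᵥ traj A B x0 u (N + k)) ⬝ᵥ
      (S *ᵥ (u (N + k) - K *ᵥ traj A B x0 u (N + k))) := fun k _ => by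
    simpa using hS.posSemidef.dotProduct_mulVec_nonneg
      (u (N + k) - K *ᵥ traj A B x0 u (N + k))
  have hsum := Finset.sum_nonneg hnn
  have hzero : ∑ k ∈ Finset.range l, (u (N + k) - K *ᵥ traj A B x0 u (N + k)) ⬝ᵥ
      (S *ᵥ (u (N + k) - K *ᵥ traj A B x0 u (N + k))) = 0 := by
    refine le_antisymm ?_ hsum
    by_contra! hpos
    nlinarith [mul_pos ht0 hpos, mul_nonneg (mul_nonneg ht0.le (sub_nonneg.2 ht1)) hpos.le]
  intro k hk
  have hk0 := (Finset.sum_eq_zero_iff_of_nonneg hnn).1 hzero k (Finset.mem_range.2 hk)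
  by_contra hne
  have := hS.dotProduct_mulVec_pos (sub_ne_zero.2 hne)
  simp only [star_trivial] at this
  exact this.ne' hk0

/-- Optimal sequences are unique. -/
lemma IsOptimal.unique {n m qX qU qT : ℕ} {A : Matrix (Fin n) (Fin n) ℝ}
    {B : Matrix (Fin n) (Fin m) ℝ} {Q P : Matrix (Fin n) (Fin n) ℝ}
    {R S : Matrix (Fin m) (Fin m) ℝ} {K : Matrix (Fin m) (Fin n) ℝ}
    {Cx : Matrix (Fin qX) (Fin n) ℝ} {cx : Fin qX → ℝ} {Cu : Matrix (Fin qU) (Fin m) ℝ}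
    {cu : Fin qU → ℝ} {Ct : Matrix (Fin qT) (Fin n) ℝ} {ct : Fin qT → ℝ}
    (hS : S.PosDef)
    (hcost : ∀ (x0 : Fin n → ℝ) (u : ℕ → Fin m → ℝ) (M : ℕ),
      cost A B Q R P M x0 u = (1 / 2) * (x0 ⬝ᵥ (P *ᵥ x0)) +
        (1 / 2) * ∑ k ∈ Finset.range M,
          (u k - K *ᵥ traj A B x0 u k) ⬝ᵥ (S *ᵥ (u k - K *ᵥ traj A B x0 u k)))
    {N : ℕ} {x0 : Fin n → ℝ} {u v : ℕ → Fin m → ℝ}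
    (hu : IsOptimal A B Q R P Cx cx Cu cu Ct ct N x0 u)
    (hv : IsOptimal A B Q R P Cx cx Cu cu Ct ct N x0 v) :
    ∀ k < N, v k = u k := by
  have hfeas : Feasible A B Cx cx Cu cu Ct ct N x0
      (fun j => u j + (1 / 2 : ℝ) • (v j - u j)) := by
    refine ⟨fun k hk => ⟨?_, ?_⟩, ?_⟩
    · rw [traj_combo]
      exact mulVec_combo_le (by norm_num) (by norm_num) (hu.1.1 k hk).1 (hv.1.1 k hk).1
    · exact mulVec_combo_le (by norm_num) (by norm_num) (hu.1.1 k hk).2 (hv.1.1 k hk).2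
    · rw [traj_combo]
      exact mulVec_combo_le (by norm_num) (by norm_num) hu.1.2 hv.1.2
  have h1 := hu.2 _ hfeas
  have h2 := hv.2 _ hfeas
  set a : ℕ → Fin m → ℝ := fun k => u k - K *ᵥ traj A B x0 u k with ha
  set b : ℕ → Fin m → ℝ := fun k => v k - K *ᵥ traj A B x0 v k with hb
  have hmid : ∀ k ∈ Finset.range N,
      (u k + (1 / 2 : ℝ) • (v k - u k) -
        K *ᵥ traj A B x0 (fun j => u j + (1 / 2 : ℝ) • (v j - u j)) k) ⬝ᵥ
        (S *ᵥ (u k + (1 / 2 : ℝ) • (v k - u k) -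
          K *ᵥ traj A B x0 (fun j => u j + (1 / 2 : ℝ) • (v j - u j)) k)) =
      (1 / 2) * (a k ⬝ᵥ (S *ᵥ a k)) + (1 / 2) * (b k ⬝ᵥ (S *ᵥ b k)) -
        (1 / 4) * ((b k - a k) ⬝ᵥ (S *ᵥ (b k - a k))) := by
    intro k _
    have he : u k + (1 / 2 : ℝ) • (v k - u k) -
        K *ᵥ traj A B x0 (fun j => u j + (1 / 2 : ℝ) • (v j - u j)) k =
        (1 / 2 : ℝ) • (a k + b k) := by
      rw [traj_combo, ha, hb]
      simp only [Matrix.mulVec_add, Matrix.mulVec_smul, Matrix.mulVec_sub]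
      module
    rw [he]
    simp only [Matrix.mulVec_smul, dotProduct_smul, smul_dotProduct, Matrix.mulVec_add,
      Matrix.mulVec_sub, dotProduct_add, add_dotProduct, dotProduct_sub, sub_dotProduct,
      smul_eq_mul]
    ring
  rw [hcost, hcost, Finset.sum_congr rfl hmid, Finset.sum_sub_distrib, Finset.sum_add_distrib,
    ← Finset.mul_sum, ← Finset.mul_sum, ← Finset.mul_sum] at h1 h2
  have hnn : ∀ k ∈ Finset.range N, 0 ≤ (b k - a k) ⬝ᵥ (S *ᵥ (b k - a k)) := fun k _ => by
    simpa using hS.posSemidef.dotProduct_mulVec_nonneg (b k - a k)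
  have hzero : ∑ k ∈ Finset.range N, (b k - a k) ⬝ᵥ (S *ᵥ (b k - a k)) = 0 := by
    refine le_antisymm ?_ (Finset.sum_nonneg hnn)
    linarith
  have hab : ∀ k < N, b k = a k := by
    intro k hk
    have hk0 := (Finset.sum_eq_zero_iff_of_nonneg hnn).1 hzero k (Finset.mem_range.2 hk)
    by_contra hne
    have := hS.dotProduct_mulVec_pos (sub_ne_zero.2 hne)
    simp only [star_trivial] at this
    exact this.ne' hk0
  intro k
  induction k using Nat.strong_induction_on with
  | _ k ih =>
    intro hk
    have ht := traj_congr A B x0 (M := k) (fun j hj => ih j hj (hj.trans hk)) k le_rfl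
    have := hab k hk
    simp only [ha, hb, ht] at this
    exact sub_left_injective this

/-- if the horizon-`(N+l)` optimal solution has no active constraints at the
stages `N, …, N+l-1` and no active terminal constraints, then its truncation is the unique
optimal solution for horizon `N`, no terminal constraint is active for horizon `N`, the
active patterns agree on the first `N` stages, and the tail is the LQR feedback. -/
theorem stmt3
    {n m qX qU qT : ℕ}
    (A : Matrix (Fin n) (Fin n) ℝ) (B : Matrix (Fin n) (Fin m) ℝ)
    (Q : Matrix (Fin n) (Fin n) ℝ) (R : Matrix (Fin m) (Fin m) ℝ)
    (P : Matrix (Fin n) (Fin n) ℝ)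
    (Cx : Matrix (Fin qX) (Fin n) ℝ) (cx : Fin qX → ℝ)
    (Cu : Matrix (Fin qU) (Fin m) ℝ) (cu : Fin qU → ℝ)
    (Ct : Matrix (Fin qT) (Fin n) ℝ) (ct : Fin qT → ℝ)
    (hQ : Q.PosSemidef) (hR : R.PosDef) (hP : P.PosSemidef)
    (Kinf : Matrix (Fin m) (Fin n) ℝ)
    (hdet : IsUnit (R + Bᵀ * P * B).det)
    (hRic : P = Aᵀ * (P - P * B * (R + Bᵀ * P * B)⁻¹ * (Bᵀ * P)) * A + Q)
    (hK : Kinf = -((Bᵀ * P * B + R)⁻¹ * (Bᵀ * P * A)))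
    (Xs : Set (Fin n → ℝ)) (hXs : Xs = {x | Cx *ᵥ x ≤ cx})
    (Us : Set (Fin m → ℝ)) (hUs : Us = {v | Cu *ᵥ v ≤ cu})
    (Ts : Set (Fin n → ℝ)) (hTs : Ts = {x | Ct *ᵥ x ≤ ct})
    (XU : Set (Fin n → ℝ)) (hXU : XU = {x ∈ Xs | Kinf *ᵥ x ∈ Us})
    (hTchar : Ts = {x ∈ Xs | ∀ k : ℕ, ((A + B * Kinf) ^ k) *ᵥ x ∈ XU})
    (hXc : IsCompact Xs) (hUc : IsCompact Us) (hTc : IsCompact Ts)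
    (hX0 : (0 : Fin n → ℝ) ∈ interior Xs)
    (hU0 : (0 : Fin m → ℝ) ∈ interior Us)
    (hT0 : (0 : Fin n → ℝ) ∈ interior Ts)
    (hXint : interior Xs = {x | ∀ i, (Cx *ᵥ x) i < cx i})
    (hUint : interior Us = {v | ∀ j, (Cu *ᵥ v) j < cu j})
    (hTint : interior Ts = {x | ∀ r, (Ct *ᵥ x) r < ct r})
    (N : ℕ) (hN : 1 ≤ N) (l : ℕ) (hl : 1 ≤ l)
    (x0 : Fin n → ℝ) (u : ℕ → Fin m → ℝ)
    (hu : IsOptimal A B Q R P Cx cx Cu cu Ct ct (N + l) x0 u)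
    (hinact : ∀ k, N ≤ k → k < N + l →
      (∀ i, (Cx *ᵥ traj A B x0 u k) i < cx i) ∧ (∀ j, (Cu *ᵥ u k) j < cu j))
    (hterm : ∀ r, (Ct *ᵥ traj A B x0 u (N + l)) r < ct r) :
    x0 ∈ FeasSet A B Cx cx Cu cu Ct ct N ∧
    IsOptimal A B Q R P Cx cx Cu cu Ct ct N x0 u ∧
    (∀ v, IsOptimal A B Q R P Cx cx Cu cu Ct ct N x0 v → ∀ k < N, v k = u k) ∧
    (∀ r, (Ct *ᵥ traj A B x0 u N) r < ct r) ∧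
    traj A B x0 u N ∈ interior Ts ∧
    (∀ k, N ≤ k → k < N + l → u k = Kinf *ᵥ traj A B x0 u k) := by
  have hRs : R.IsSymm := by simpa using hR.isHermitian
  have hPs : P.IsSymm := by simpa using hP.isHermitian
  have hS : (R + Bᵀ * P * B).PosDef :=
    hR.add_posSemidef (by simpa using hP.conjTranspose_mul_mul_same B)
  have hcost := cost_eq_add_sum (A := A) (B := B) (riccati_stage hRs hPs hdet hRic hK)
  have htail := hu.tail_eq_feedback hS hcost hinact hterm
  have hpow := traj_add_eq_pow_mulVec htail
  have hmemT : ∀ x, x ∈ Ts ↔ x ∈ Xs ∧ ∀ k : ℕ, ((A + B * Kinf) ^ k) *ᵥ x ∈ XU := fun x => by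
    conv_lhs => rw [hTchar]
    rfl
  have hcont : ∀ k : ℕ, Continuous fun z => ((A + B * Kinf) ^ k) *ᵥ z := fun k =>
    Continuous.matrix_mulVec continuous_const continuous_id
  have hint : traj A B x0 u N ∈ interior Ts := by
    rw [mem_interior_iff_mem_nhds]
    have hend : ∀ᶠ z in nhds (traj A B x0 u N), ((A + B * Kinf) ^ l) *ᵥ z ∈ interior Ts :=
      (hcont l).continuousAt.eventually_mem (isOpen_interior.mem_nhds (by
        rw [← hpow l le_rfl, hTint]
        exact hterm))
    have hstage : ∀ᶠ z in nhds (traj A B x0 u N), ∀ k ∈ Finset.range l,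
        ((A + B * Kinf) ^ k) *ᵥ z ∈ XU := by
      rw [Filter.eventually_all_finset]
      intro k hk
      rw [Finset.mem_range] at hk
      have hin := hinact (N + k) (by omega) (by omega)
      rw [htail k hk, hpow k hk.le] at hin
      have h1 : ∀ᶠ z in nhds (traj A B x0 u N), ((A + B * Kinf) ^ k) *ᵥ z ∈ interior Xs :=
        (hcont k).continuousAt.eventually_mem (isOpen_interior.mem_nhds (by
          rw [hXint]
          exact hin.1))
      have h2 : ∀ᶠ z in nhds (traj A B x0 u N),
          Kinf *ᵥ (((A + B * Kinf) ^ k) *ᵥ z) ∈ interior Us :=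
        (Continuous.matrix_mulVec continuous_const
          (hcont k)).continuousAt.eventually_mem (isOpen_interior.mem_nhds (by
            rw [hUint]
            exact hin.2))
      filter_upwards [h1, h2] with z hz1 hz2
      rw [hXU]
      exact ⟨interior_subset hz1, interior_subset hz2⟩
    filter_upwards [hend, hstage] with z hz1 hz2
    have hall : ∀ k : ℕ, ((A + B * Kinf) ^ k) *ᵥ z ∈ XU := by
      intro k
      rcases lt_or_ge k l with h | h
      · exact hz2 k (Finset.mem_range.2 h)
      · have := ((hmemT _).1 (interior_subset hz1)).2 (k - l)
        rwa [Matrix.mulVec_mulVec, ← pow_add, Nat.sub_add_cancel h] at this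
    have h0 := hall 0
    rw [hXU] at h0
    exact (hmemT z).2 ⟨by simpa using h0.1, hall⟩
  have hstrict : ∀ r, (Ct *ᵥ traj A B x0 u N) r < ct r := by
    have := hint
    rwa [hTint] at this
  have hfeas : Feasible A B Cx cx Cu cu Ct ct N x0 u :=
    ⟨fun k hk => hu.1.1 k (by omega), fun r => (hstrict r).le⟩
  have hopt : IsOptimal A B Q R P Cx cx Cu cu Ct ct N x0 u := by
    refine ⟨hfeas, fun v hv => ?_⟩
    have hvT : traj A B x0 v N ∈ Ts := by
      rw [hTs]
      exact hv.2
    have hvT' := ((hmemT _).1 hvT).2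
    have hext : Feasible A B Cx cx Cu cu Ct ct (N + l) x0 (feedbackExt A B Kinf N x0 v) := by
      refine ⟨fun k hk => ?_, ?_⟩
      · rcases lt_or_ge k N with h | h
        · rw [traj_feedbackExt_of_le A B Kinf N x0 v h.le, feedbackExt_of_lt h]
          exact hv.1 k h
        · obtain ⟨j, rfl⟩ := Nat.exists_eq_add_of_le h
          rw [feedbackExt_add, traj_feedbackExt_add]
          have := hvT' j
          rw [hXU, hXs, hUs] at this
          exact this
      · rw [traj_feedbackExt_add]
        have hl : ((A + B * Kinf) ^ l) *ᵥ traj A B x0 v N ∈ Ts := by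
          refine (hmemT _).2 ⟨?_, fun k => ?_⟩
          · have := hvT' l
            rw [hXU] at this
            exact this.1
          · rw [Matrix.mulVec_mulVec, ← pow_add]
            exact hvT' _
        rw [hTs] at hl
        exact hl
    have hle := hu.2 _ hext
    have hu0 : ∑ k ∈ Finset.range l, (u (N + k) - Kinf *ᵥ traj A B x0 u (N + k)) ⬝ᵥ
        ((R + Bᵀ * P * B) *ᵥ (u (N + k) - Kinf *ᵥ traj A B x0 u (N + k))) = 0 :=
      Finset.sum_eq_zero fun k hk => by
        rw [sub_eq_zero.2 (htail k (Finset.mem_range.1 hk)), zero_dotProduct]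
    have hv0 : ∑ k ∈ Finset.range l, (feedbackExt A B Kinf N x0 v (N + k) -
        Kinf *ᵥ traj A B x0 (feedbackExt A B Kinf N x0 v) (N + k)) ⬝ᵥ
        ((R + Bᵀ * P * B) *ᵥ (feedbackExt A B Kinf N x0 v (N + k) -
          Kinf *ᵥ traj A B x0 (feedbackExt A B Kinf N x0 v) (N + k))) = 0 :=
      Finset.sum_eq_zero fun k _ => by
        rw [sub_eq_zero.2 (feedbackExt_add A B Kinf N x0 v k), zero_dotProduct]
    rw [hcost, hcost, Finset.sum_range_add, Finset.sum_range_add, hu0, hv0, add_zero, add_zero,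
      ← hcost] at hle
    refine hle.trans_eq ?_
    rw [hcost]
    congr 2
    refine Finset.sum_congr rfl fun k hk => ?_
    rw [traj_feedbackExt_of_le A B Kinf N x0 v (Finset.mem_range.1 hk).le,
      feedbackExt_of_lt (Finset.mem_range.1 hk)]
  refine ⟨⟨u, hfeas⟩, hopt, fun v hv => hopt.unique hS hcost hv, hstrict, hint,
    fun k hk hk' => ?_⟩
  obtain ⟨j, rfl⟩ := Nat.exists_eq_add_of_le hk
  exact htail j (by omega)
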